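/- Fix (ξ, ζ) ∈ D^{J+K} and T > 0. The successive approximation sequence defined by y^0 ≡ 0 and, for n ≥ 1 and k ∈ [K], y_k^n := ζ_k − η_k ∫_0^· y_k^{n−1}(s) ds − Σ_{j=1}^J p_{jk} ψ( ξ_j + Σ_{l=1}^K q_{lj} η_l ∫_0^· y_l^{n−1}(s) ds ), converges uniformly on [0,T] (in the norm ‖y‖_{T,K} := max_{k∈[K]} sup_{t∈[0,T]} |y_k(t)|) to the unique càdlàg function y on [0,T] satisfying, for all k ∈ [K] and t ∈ [0,T], y_k(t) = ζ_k(t) − η_k ∫_0^t y_k(s) ds − Σ_{j=1}^J p_{jk} ψ( ξ_j + Σ_{l=1}^K q_{lj} η_l ∫_0^· y_l(s) ds )(t). -/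

import Mathlib

open MeasureTheory Set Filter

/-- One-sided reflection map: `psi x t = sup_{s ∈ [0,t]} max (-x s) 0`. -/
noncomputable def psi (x : ℝ → ℝ) (t : ℝ) : ℝ :=
  sSup ((fun s => max (-x s) 0) '' Set.Icc 0 t)

/-- `phi x t = x t + psi x t`. -/
noncomputable def phi (x : ℝ → ℝ) (t : ℝ) : ℝ := x t + psi x t

/-- Càdlàg on `[0,∞)`: right continuous on `[0,∞)`, left limits on `(0,∞)`. -/
def Cadlag (x : ℝ → ℝ) : Prop :=
  (∀ t : ℝ, 0 ≤ t → ContinuousWithinAt x (Set.Ici t) t) ∧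
  (∀ t : ℝ, 0 < t → ∃ L : ℝ, Filter.Tendsto x (nhdsWithin t (Set.Iio t)) (nhds L))

/-- Càdlàg on `[0,T]`: right continuous on `[0,T)`, left limits on `(0,T]`. -/
def CadlagOn (x : ℝ → ℝ) (T : ℝ) : Prop :=
  (∀ t : ℝ, 0 ≤ t → t < T → ContinuousWithinAt x (Set.Ici t) t) ∧
  (∀ t : ℝ, 0 < t → t ≤ T → ∃ L : ℝ, Filter.Tendsto x (nhdsWithin t (Set.Iio t)) (nhds L))

/-- Sup norm of `x` on `[0,T]`. -/
noncomputable def supNorm (x : ℝ → ℝ) (T : ℝ) : ℝ :=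
  sSup ((fun t => |x t|) '' Set.Icc 0 T)

/-- `y` is a càdlàg solution of equation (A.1) on `[0,∞)` for input `(ξ, ζ)`. -/
def IsSolA1 {J K : ℕ} (η : Fin K → ℝ) (p : Fin J → Fin K → ℝ) (q : Fin K → Fin J → ℝ)
    (ξ : Fin J → ℝ → ℝ) (ζ : Fin K → ℝ → ℝ) (y : Fin K → ℝ → ℝ) : Prop :=
  (∀ k, Cadlag (y k)) ∧
  ∀ k, ∀ t : ℝ, 0 ≤ t →
    y k t = ζ k t - η k * (∫ s in (0:ℝ)..t, y k s)
      - ∑ j, p j k *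
          psi (fun r => ξ j r + ∑ l, q l j * η l * (∫ s in (0:ℝ)..r, y l s)) t

open scoped Topology Nat

/-! ### Càdlàg functions on a compact interval -/

theorem Cadlag.cadlagOn {x : ℝ → ℝ} (hx : Cadlag x) (T : ℝ) : CadlagOn x T :=
  ⟨fun t ht _ => hx.1 t ht, fun t ht _ => hx.2 t ht⟩

namespace CadlagOn

variable {x y : ℝ → ℝ} {T : ℝ}

theorem mono (hx : CadlagOn x T) {S : ℝ} (hS : S ≤ T) : CadlagOn x S :=
  ⟨fun t ht htS => hx.1 t ht (htS.trans_le hS), fun t ht htS => hx.2 t ht (htS.trans hS)⟩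

theorem of_continuousOn (hx : ContinuousOn x (Icc 0 T)) : CadlagOn x T := by
  refine ⟨fun t ht htT => ?_, fun t ht htT => ⟨x t, ?_⟩⟩
  · exact (hx t ⟨ht, htT.le⟩).mono_of_mem_nhdsWithin
      (mem_of_superset (Icc_mem_nhdsGE htT) (Icc_subset_Icc_left ht))
  · exact (hx t ⟨ht.le, htT⟩).mono_left <| nhdsWithin_le_of_mem <|
      mem_of_superset (Ico_mem_nhdsLT ht)
        (Ico_subset_Icc_self.trans (Icc_subset_Icc_right htT))

theorem add (hx : CadlagOn x T) (hy : CadlagOn y T) : CadlagOn (fun t => x t + y t) T := by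
  refine ⟨fun t ht htT => (hx.1 t ht htT).add (hy.1 t ht htT), fun t ht htT => ?_⟩
  obtain ⟨L, hL⟩ := hx.2 t ht htT
  obtain ⟨L', hL'⟩ := hy.2 t ht htT
  exact ⟨L + L', hL.add hL'⟩

theorem const_mul (c : ℝ) (hx : CadlagOn x T) : CadlagOn (fun t => c * x t) T := by
  refine ⟨fun t ht htT => continuousWithinAt_const.mul (hx.1 t ht htT), fun t ht htT => ?_⟩
  obtain ⟨L, hL⟩ := hx.2 t ht htT
  exact ⟨c * L, hL.const_mul c⟩

theorem sub (hx : CadlagOn x T) (hy : CadlagOn y T) : CadlagOn (fun t => x t - y t) T := by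
  simpa [sub_eq_add_neg] using hx.add (hy.const_mul (-1))

theorem sum {ι : Type*} (s : Finset ι) {f : ι → ℝ → ℝ} (hf : ∀ i ∈ s, CadlagOn (f i) T) :
    CadlagOn (fun t => ∑ i ∈ s, f i t) T := by
  classical
  induction s using Finset.induction_on with
  | empty => simpa using of_continuousOn (continuousOn_const (c := (0 : ℝ)))
  | insert a s ha ih =>
    simp only [Finset.sum_insert ha]
    exact (hf a (Finset.mem_insert_self a s)).add
      (ih fun i hi => hf i (Finset.mem_insert_of_mem hi))

theorem exists_abs_le (hx : CadlagOn x T) : ∃ M, ∀ t ∈ Icc 0 T, |x t| ≤ M := by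
  refine isCompact_Icc.induction_on (p := fun s => ∃ M, ∀ t ∈ s, |x t| ≤ M)
    ⟨0, by simp⟩ (fun s t hst ⟨M, hM⟩ => ⟨M, fun u hu => hM u (hst hu)⟩) ?_ ?_
  · rintro s t ⟨M, hM⟩ ⟨N, hN⟩
    refine ⟨max M N, fun u hu => ?_⟩
    rcases hu with hu | hu
    · exact (hM u hu).trans (le_max_left _ _)
    · exact (hN u hu).trans (le_max_right _ _)
  · intro t ht
    have hright : ∃ M, ∀ᶠ u in 𝓝[≥] t, u ∈ Icc 0 T → |x u| ≤ M := by
      rcases ht.2.lt_or_eq with htT | rfl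
      · refine ⟨|x t| + 1, ?_⟩
        filter_upwards [(hx.1 t ht.1 htT).abs.eventually_le_const (lt_add_one |x t|)] with u hu _
        exact hu
      · refine ⟨|x t|, ?_⟩
        filter_upwards [self_mem_nhdsWithin] with u hu hu'
        rw [le_antisymm hu'.2 hu]
    have hleft : ∃ M, ∀ᶠ u in 𝓝[<] t, u ∈ Icc 0 T → |x u| ≤ M := by
      rcases ht.1.lt_or_eq with h0t | rfl
      · obtain ⟨L, hL⟩ := hx.2 t h0t ht.2
        refine ⟨|L| + 1, ?_⟩
        filter_upwards [hL.abs.eventually_le_const (lt_add_one |L|)] with u hu _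
        exact hu
      · refine ⟨0, ?_⟩
        filter_upwards [self_mem_nhdsWithin] with u hu hu'
        exact absurd hu'.1 (not_le.2 hu)
    obtain ⟨M, hM⟩ := hright
    obtain ⟨N, hN⟩ := hleft
    have key : ∀ᶠ u in 𝓝 t, u ∈ Icc 0 T → |x u| ≤ max M N := by
      rw [← nhdsLT_sup_nhdsGE, eventually_sup]
      exact ⟨hN.mono fun u h hu => (h hu).trans (le_max_right _ _),
        hM.mono fun u h hu => (h hu).trans (le_max_left _ _)⟩
    exact ⟨_, eventually_nhdsWithin_iff.2 key, max M N, fun u hu => hu⟩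

theorem aestronglyMeasurable (hx : CadlagOn x T) :
    AEStronglyMeasurable x (volume.restrict (Icc 0 T)) := by
  let a : ℕ → ℝ → ℝ := fun n t => ((⌊t * ((n : ℝ) + 1)⌋ : ℝ) + 1) / ((n : ℝ) + 1)
  have ha_lt : ∀ n t, t < a n t := fun n t => by
    have hn : (0 : ℝ) < (n : ℝ) + 1 := by positivity
    exact (lt_div_iff₀ hn).2 (Int.lt_floor_add_one _)
  have ha_le : ∀ n t, a n t ≤ t + 1 / ((n : ℝ) + 1) := fun n t => by
    have hn : (0 : ℝ) < (n : ℝ) + 1 := by positivity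
    have h := Int.floor_le (t * ((n : ℝ) + 1))
    rw [div_le_iff₀ hn, add_mul, one_div, inv_mul_cancel₀ hn.ne']
    linarith
  have ha : ∀ t, Tendsto (fun n => a n t) atTop (𝓝 t) := by
    intro t
    have h : Tendsto (fun n : ℕ => t + 1 / ((n : ℝ) + 1)) atTop (𝓝 t) := by
      simpa using tendsto_one_div_add_atTop_nhds_zero_nat.const_add t
    exact tendsto_of_tendsto_of_tendsto_of_le_of_le tendsto_const_nhds h
      (fun n => (ha_lt n t).le) (fun n => ha_le n t)
  refine aestronglyMeasurable_of_tendsto_ae (f := fun n t => x (min T (a n t))) atTop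
    (fun n => ?_) ?_
  · have h : Measurable fun m : ℤ => x (min T (((m : ℝ) + 1) / ((n : ℝ) + 1))) :=
      measurable_from_top
    exact (h.comp (Int.measurable_floor.comp
      (measurable_id.mul_const ((n : ℝ) + 1)))).aestronglyMeasurable
  · filter_upwards [ae_restrict_mem measurableSet_Icc] with t ht
    rcases ht.2.lt_or_eq with htT | rfl
    · refine (hx.1 t ht.1 htT).tendsto.comp (tendsto_nhdsWithin_iff.2 ⟨?_, ?_⟩)
      · simpa [min_eq_right htT.le] using (tendsto_const_nhds (x := T)).min (ha t)
      · exact Eventually.of_forall fun n => le_min htT.le (ha_lt n t).le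
    · simp only [min_eq_left (ha_lt _ t).le]
      exact tendsto_const_nhds

theorem integrableOn (hx : CadlagOn x T) : IntegrableOn x (Icc 0 T) := by
  obtain ⟨M, hM⟩ := hx.exists_abs_le
  exact IntegrableOn.of_bound measure_Icc_lt_top hx.aestronglyMeasurable M
    ((ae_restrict_mem measurableSet_Icc).mono hM)

theorem intervalIntegrable (hx : CadlagOn x T) {t : ℝ} (ht : t ∈ Icc 0 T) :
    IntervalIntegrable x volume 0 t :=
  (intervalIntegrable_iff_integrableOn_Icc_of_le ht.1).2
    (hx.integrableOn.mono_set (Icc_subset_Icc_right ht.2))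

theorem integral (hx : CadlagOn x T) : CadlagOn (fun t => ∫ s in (0:ℝ)..t, x s) T := by
  rcases le_or_gt 0 T with hT | hT
  · refine of_continuousOn ?_
    have h : IntegrableOn x (uIcc 0 T) := by rw [uIcc_of_le hT]; exact hx.integrableOn
    simpa only [uIcc_of_le hT] using intervalIntegral.continuousOn_primitive_interval h
  · exact of_continuousOn (by simp [Icc_eq_empty_of_lt hT])

theorem bddAbove_neg_part (hx : CadlagOn x T) :
    BddAbove ((fun s => max (-x s) 0) '' Icc 0 T) := by
  obtain ⟨M, hM⟩ := hx.exists_abs_le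
  refine ⟨M, forall_mem_image.2 fun s hs => ?_⟩
  exact max_le ((neg_le_abs _).trans (hM s hs)) ((abs_nonneg _).trans (hM s hs))

theorem monotoneOn_psi (hx : CadlagOn x T) : MonotoneOn (psi x) (Icc 0 T) :=
  fun _ hs _ ht hst => csSup_le_csSup (hx.mono ht.2).bddAbove_neg_part
    ((nonempty_Icc.2 hs.1).image _) (image_mono (Icc_subset_Icc_right hst))

theorem psi (hx : CadlagOn x T) : CadlagOn (psi x) T := by
  refine ⟨fun t ht htT => ?_, fun t ht htT => ?_⟩
  · rw [Metric.continuousWithinAt_iff']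
    intro ε hε
    obtain ⟨v, hv, hvx⟩ := (mem_nhdsGE_iff_exists_Ico_subset (a := t)).1
      (Metric.continuousWithinAt_iff'.1 (hx.1 t ht htT) (ε / 2) (half_pos hε))
    filter_upwards [Ico_mem_nhdsGE hv, Icc_mem_nhdsGE htT] with u hu huT
    have hmono : _root_.psi x t ≤ _root_.psi x u :=
      hx.monotoneOn_psi ⟨ht, htT.le⟩ ⟨ht.trans hu.1, huT.2⟩ hu.1
    have hle : ∀ s ∈ Icc 0 t, max (-x s) 0 ≤ _root_.psi x t := fun s hs =>
      le_csSup (hx.mono htT.le).bddAbove_neg_part (mem_image_of_mem _ hs)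
    have hupper : _root_.psi x u ≤ _root_.psi x t + ε / 2 := by
      refine csSup_le ((nonempty_Icc.2 (ht.trans hu.1)).image _)
        (forall_mem_image.2 fun s hs => ?_)
      rcases le_or_gt s t with hst | hst
      · exact (hle s ⟨hs.1, hst⟩).trans (by linarith)
      · have hd : |x s - x t| < ε / 2 := hvx ⟨hst.le, hs.2.trans_lt hu.2⟩
        have h0 := hle t ⟨ht, le_rfl⟩
        have h1 := (le_max_left (-x t) 0).trans h0
        have h2 := (le_max_right (-x t) 0).trans h0
        have h3 := (abs_lt.1 hd).1
        exact max_le (by linarith) (by linarith)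
    rw [Real.dist_eq, abs_of_nonneg (by linarith)]
    linarith
  · have hsub : Ioo 0 t ⊆ Icc 0 T := Ioo_subset_Icc_self.trans (Icc_subset_Icc_right htT)
    refine ⟨_, MonotoneOn.tendsto_nhdsWithin_Ioo_left (nonempty_Ioo.2 ht)
      (hx.monotoneOn_psi.mono hsub) ⟨_root_.psi x t, forall_mem_image.2 fun s hs => ?_⟩⟩
    exact hx.monotoneOn_psi (hsub hs) ⟨ht.le, htT⟩ hs.2.le

theorem of_tendstoUniformlyOn {f : ℕ → ℝ → ℝ} (hf : ∀ n, CadlagOn (f n) T)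
    (h : TendstoUniformlyOn f x atTop (Icc 0 T)) : CadlagOn x T := by
  rw [Metric.tendstoUniformlyOn_iff] at h
  refine ⟨fun t ht htT => ?_, fun t ht htT => ?_⟩
  · refine continuousWithinAt_of_locally_uniform_approx_of_continuousWithinAt self_mem_Ici
      fun u hu => ?_
    obtain ⟨ε, hε, hεu⟩ := Metric.mem_uniformity_dist.1 hu
    obtain ⟨n, hn⟩ := (h ε hε).exists
    exact ⟨Icc t T, Icc_mem_nhdsGE htT, f n, (hf n).1 t ht htT,
      fun s hs => hεu (hn s ⟨ht.trans hs.1, hs.2⟩)⟩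
  · refine cauchy_map_iff_exists_tendsto.1 (Metric.cauchy_iff.2 ⟨inferInstance, fun ε hε => ?_⟩)
    obtain ⟨n, hn⟩ := (h (ε / 4) (by positivity)).exists
    obtain ⟨L, hL⟩ := (hf n).2 t ht htT
    have hball : ∀ᶠ s in 𝓝[<] t, dist (x s) L < ε / 2 := by
      filter_upwards [Metric.tendsto_nhds.1 hL (ε / 4) (by positivity), Ico_mem_nhdsLT ht]
        with s hs hs'
      have := hn s ⟨hs'.1, hs'.2.le.trans htT⟩
      linarith [dist_triangle (x s) (f n s) L]
    refine ⟨Metric.ball L (ε / 2), hball, fun a ha b hb => ?_⟩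
    rw [Metric.mem_ball] at ha hb
    linarith [dist_triangle_right a b L]

end CadlagOn

theorem abs_psi_sub_psi_le {x y : ℝ → ℝ} {t c : ℝ} (ht : 0 ≤ t) (hx : CadlagOn x t)
    (hy : CadlagOn y t) (h : ∀ s ∈ Icc 0 t, |x s - y s| ≤ c) : |psi x t - psi y t| ≤ c := by
  have aux : ∀ {x y : ℝ → ℝ}, CadlagOn y t → (∀ s ∈ Icc 0 t, |x s - y s| ≤ c) →
      psi x t ≤ psi y t + c := by
    intro x y hy h
    refine csSup_le ((nonempty_Icc.2 ht).image _) (forall_mem_image.2 fun s hs => ?_)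
    have h0 : max (-y s) 0 ≤ psi y t := le_csSup hy.bddAbove_neg_part (mem_image_of_mem _ hs)
    have h1 := (le_max_left (-y s) 0).trans h0
    have h2 := (le_max_right (-y s) 0).trans h0
    have h3 := abs_le.1 (h s hs)
    exact max_le (by linarith) (by linarith)
  have h1 := aux hy h
  have h2 := aux hx fun s hs => by rw [abs_sub_comm]; exact h s hs
  exact abs_le.2 ⟨by linarith, by linarith⟩

/-! ### The Picard operator -/

section Picard

variable {J K : ℕ}

/-- The argument of the reflection map in the `j`-th term of equation (A.1). -/
noncomputable def netInput (η : Fin K → ℝ) (q : Fin K → Fin J → ℝ) (ξ : Fin J → ℝ → ℝ)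
    (y : Fin K → ℝ → ℝ) (j : Fin J) (r : ℝ) : ℝ :=
  ξ j r + ∑ l, q l j * η l * (∫ s in (0:ℝ)..r, y l s)

/-- The operator whose fixed points are the solutions of equation (A.1). -/
noncomputable def picard (η : Fin K → ℝ) (p : Fin J → Fin K → ℝ) (q : Fin K → Fin J → ℝ)
    (ξ : Fin J → ℝ → ℝ) (ζ : Fin K → ℝ → ℝ) (y : Fin K → ℝ → ℝ) (k : Fin K) (t : ℝ) : ℝ :=
  ζ k t - η k * (∫ s in (0:ℝ)..t, y k s) - ∑ j, p j k * psi (netInput η q ξ y j) t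

variable {η : Fin K → ℝ} {p : Fin J → Fin K → ℝ} {q : Fin K → Fin J → ℝ}
  {ξ : Fin J → ℝ → ℝ} {ζ : Fin K → ℝ → ℝ} {y z : Fin K → ℝ → ℝ} {T : ℝ}

theorem cadlagOn_netInput (hξ : ∀ j, CadlagOn (ξ j) T) (hy : ∀ k, CadlagOn (y k) T) (j : Fin J) :
    CadlagOn (netInput η q ξ y j) T :=
  (hξ j).add (CadlagOn.sum _ fun l _ => (hy l).integral.const_mul _)

theorem cadlagOn_picard (hξ : ∀ j, CadlagOn (ξ j) T) (hζ : ∀ k, CadlagOn (ζ k) T)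
    (hy : ∀ k, CadlagOn (y k) T) (k : Fin K) : CadlagOn (picard η p q ξ ζ y k) T :=
  ((hζ k).sub ((hy k).integral.const_mul _)).sub
    (CadlagOn.sum _ fun j _ => (cadlagOn_netInput hξ hy j).psi.const_mul _)

theorem abs_integral_sub_integral_le {f g : ℝ → ℝ} (hf : CadlagOn f T) (hg : CadlagOn g T)
    {M : ℝ} {n : ℕ} (h : ∀ s ∈ Icc 0 T, |f s - g s| ≤ M * (s ^ n / n !)) {t : ℝ}
    (ht : t ∈ Icc 0 T) :
    |(∫ s in (0:ℝ)..t, f s) - ∫ s in (0:ℝ)..t, g s| ≤ M * (t ^ (n + 1) / (n + 1)!) := by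
  rw [← intervalIntegral.integral_sub (hf.intervalIntegrable ht) (hg.intervalIntegrable ht)]
  have hint : ∫ s in (0:ℝ)..t, M * (s ^ n / n !) = M * (t ^ (n + 1) / (n + 1)!) := by
    rw [intervalIntegral.integral_const_mul, intervalIntegral.integral_div, integral_pow,
      Nat.factorial_succ]
    push_cast
    simp [div_div]
  rw [← hint, ← Real.norm_eq_abs]
  refine intervalIntegral.norm_integral_le_of_norm_le ht.1 (ae_of_all _ fun s hs => ?_)
    (Continuous.intervalIntegrable (by fun_prop) _ _)
  exact h s ⟨hs.1.le, hs.2.trans ht.2⟩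

theorem abs_picard_sub_picard_le (hη : ∀ k, 0 ≤ η k) (hp : ∀ j k, 0 ≤ p j k)
    (hq : ∀ k j, 0 ≤ q k j) (hξ : ∀ j, CadlagOn (ξ j) T) (hy : ∀ k, CadlagOn (y k) T)
    (hz : ∀ k, CadlagOn (z k) T) {M : ℝ} (hM : 0 ≤ M) {n : ℕ}
    (h : ∀ k, ∀ s ∈ Icc 0 T, |y k s - z k s| ≤ M * (s ^ n / n !)) (k : Fin K) {t : ℝ}
    (ht : t ∈ Icc 0 T) :
    |picard η p q ξ ζ y k t - picard η p q ξ ζ z k t| ≤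
      (η k + ∑ j, p j k * ∑ l, q l j * η l) * (M * (t ^ (n + 1) / (n + 1)!)) := by
  set B := M * (t ^ (n + 1) / (n + 1)!) with hB
  have hI : ∀ l, ∀ r ∈ Icc 0 t, |(∫ s in (0:ℝ)..r, y l s) - ∫ s in (0:ℝ)..r, z l s| ≤ B := by
    intro l r hr
    refine (abs_integral_sub_integral_le (hy l) (hz l) (h l) ⟨hr.1, hr.2.trans ht.2⟩).trans ?_
    have := hr.1
    have := hr.2
    rw [hB]
    gcongr
  have hψ : ∀ j, |psi (netInput η q ξ y j) t - psi (netInput η q ξ z j) t| ≤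
      (∑ l, q l j * η l) * B := by
    intro j
    refine abs_psi_sub_psi_le ht.1 ((cadlagOn_netInput hξ hy j).mono ht.2)
      ((cadlagOn_netInput hξ hz j).mono ht.2) fun r hr => ?_
    simp only [netInput, add_sub_add_left_eq_sub]
    rw [← Finset.sum_sub_distrib, Finset.sum_mul]
    refine (Finset.abs_sum_le_sum_abs _ _).trans (Finset.sum_le_sum fun l _ => ?_)
    have hqη : 0 ≤ q l j * η l := mul_nonneg (hq l j) (hη l)
    rw [← mul_sub, abs_mul, abs_of_nonneg hqη]
    exact mul_le_mul_of_nonneg_left (hI l r hr) hqη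
  have hsplit : picard η p q ξ ζ y k t - picard η p q ξ ζ z k t =
      -(η k * ((∫ s in (0:ℝ)..t, y k s) - ∫ s in (0:ℝ)..t, z k s)) -
        ∑ j, p j k * (psi (netInput η q ξ y j) t - psi (netInput η q ξ z j) t) := by
    simp only [picard, mul_sub, Finset.sum_sub_distrib]
    ring
  rw [hsplit, add_mul, Finset.sum_mul]
  refine (abs_sub _ _).trans (add_le_add ?_ ?_)
  · rw [abs_neg, abs_mul, abs_of_nonneg (hη k)]
    exact mul_le_mul_of_nonneg_left (hI k t ⟨ht.1, le_rfl⟩) (hη k)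
  · refine (Finset.abs_sum_le_sum_abs _ _).trans (Finset.sum_le_sum fun j _ => ?_)
    rw [abs_mul, abs_of_nonneg (hp j k), mul_assoc]
    exact mul_le_mul_of_nonneg_left (hψ j) (hp j k)

theorem exists_picard_bound (hη : ∀ k, 0 ≤ η k) (hp : ∀ j k, 0 ≤ p j k)
    (hq : ∀ k j, 0 ≤ q k j) (hξ : ∀ j, CadlagOn (ξ j) T) :
    ∃ C, 0 ≤ C ∧ ∀ y z : Fin K → ℝ → ℝ, (∀ k, CadlagOn (y k) T) → (∀ k, CadlagOn (z k) T) →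
      ∀ (M : ℝ) (n : ℕ), 0 ≤ M →
      (∀ k, ∀ s ∈ Icc 0 T, |y k s - z k s| ≤ M * (s ^ n / n !)) →
      ∀ k, ∀ t ∈ Icc 0 T, |picard η p q ξ ζ y k t - picard η p q ξ ζ z k t| ≤
        (C * M) * (t ^ (n + 1) / (n + 1)!) := by
  have hnn : ∀ k, 0 ≤ η k + ∑ j, p j k * ∑ l, q l j * η l := fun k =>
    add_nonneg (hη k) (Finset.sum_nonneg fun j _ => mul_nonneg (hp j k)
      (Finset.sum_nonneg fun l _ => mul_nonneg (hq l j) (hη l)))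
  refine ⟨∑ k, (η k + ∑ j, p j k * ∑ l, q l j * η l), Finset.sum_nonneg fun k _ => hnn k,
    fun y z hy hz M n hM h k t ht => ?_⟩
  refine (abs_picard_sub_picard_le hη hp hq hξ hy hz hM h k ht).trans ?_
  rw [mul_assoc]
  have := ht.1
  exact mul_le_mul_of_nonneg_right
    (Finset.single_le_sum (f := fun k => η k + ∑ j, p j k * ∑ l, q l j * η l)
      (fun k _ => hnn k) (Finset.mem_univ k)) (by positivity)

end Picard

theorem exists_abs_sub_le {K : ℕ} {T : ℝ} {y z : Fin K → ℝ → ℝ} (hy : ∀ k, CadlagOn (y k) T)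
    (hz : ∀ k, CadlagOn (z k) T) :
    ∃ M, 0 ≤ M ∧ ∀ k, ∀ t ∈ Icc 0 T, |y k t - z k t| ≤ M := by
  choose M hM using fun k => ((hy k).sub (hz k)).exists_abs_le
  refine ⟨∑ k, |M k|, Finset.sum_nonneg fun k _ => abs_nonneg _, fun k t ht => ?_⟩
  exact ((hM k t ht).trans (le_abs_self _)).trans
    (Finset.single_le_sum (f := fun k => |M k|) (fun k _ => abs_nonneg _) (Finset.mem_univ k))

/-- The successive approximations converge uniformly on `[0,T]` to the unique càdlàg
solution of equation (A.1) on `[0,T]`. -/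
theorem stmt13
    (J K : ℕ) (hJ : 0 < J) (hK : 0 < K)
    (μ : Fin J → ℝ) (hμ : ∀ j, 0 < μ j)
    (η : Fin K → ℝ) (hη : ∀ k, 0 < η k)
    (p : Fin J → Fin K → ℝ) (hp : ∀ j k, 0 ≤ p j k) (hprow : ∀ j, ∑ k, p j k = 1)
    (q : Fin K → Fin J → ℝ) (hq : ∀ k j, 0 ≤ q k j) (hqrow : ∀ k, ∑ j, q k j = 1)
    (ξ : Fin J → ℝ → ℝ) (hξ : ∀ j, Cadlag (ξ j))
    (ζ : Fin K → ℝ → ℝ) (hζ : ∀ k, Cadlag (ζ k))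
    (T : ℝ) (hT : 0 < T)
    (yseq : ℕ → Fin K → ℝ → ℝ)
    (h0 : ∀ k, ∀ t : ℝ, yseq 0 k t = 0)
    (hrec : ∀ n : ℕ, ∀ k, ∀ t : ℝ,
      yseq (n + 1) k t =
        ζ k t - η k * (∫ s in (0:ℝ)..t, yseq n k s)
          - ∑ j, p j k *
              psi (fun r => ξ j r + ∑ l, q l j * η l * (∫ s in (0:ℝ)..r, yseq n l s)) t) :
    ∃ y : Fin K → ℝ → ℝ,
      (∀ k, CadlagOn (y k) T) ∧
      (∀ k, ∀ t ∈ Set.Icc (0:ℝ) T,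
        y k t = ζ k t - η k * (∫ s in (0:ℝ)..t, y k s)
          - ∑ j, p j k *
              psi (fun r => ξ j r + ∑ l, q l j * η l * (∫ s in (0:ℝ)..r, y l s)) t) ∧
      (∀ y' : Fin K → ℝ → ℝ,
        (∀ k, CadlagOn (y' k) T) →
        (∀ k, ∀ t ∈ Set.Icc (0:ℝ) T,
          y' k t = ζ k t - η k * (∫ s in (0:ℝ)..t, y' k s)
            - ∑ j, p j k *
                psi (fun r => ξ j r + ∑ l, q l j * η l * (∫ s in (0:ℝ)..r, y' l s)) t) →
        ∀ k, ∀ t ∈ Set.Icc (0:ℝ) T, y' k t = y k t) ∧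
      (∀ k, TendstoUniformlyOn (fun n => yseq n k) (y k) Filter.atTop (Set.Icc 0 T)) := by
  have hξT : ∀ j, CadlagOn (ξ j) T := fun j => (hξ j).cadlagOn T
  have hζT : ∀ k, CadlagOn (ζ k) T := fun k => (hζ k).cadlagOn T
  have hstep : ∀ n, yseq (n + 1) = picard η p q ξ ζ (yseq n) := fun n =>
    funext fun k => funext fun t => hrec n k t
  have hseq : ∀ n k, CadlagOn (yseq n k) T := by
    intro n
    induction n with
    | zero =>
      intro k
      rw [show yseq 0 k = fun _ => 0 from funext (h0 k)]
      exact CadlagOn.of_continuousOn continuousOn_const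
    | succ n ih => rw [hstep]; exact cadlagOn_picard hξT hζT ih
  obtain ⟨C, hC, hpic⟩ := exists_picard_bound (ζ := ζ) (fun k => (hη k).le) hp hq hξT
  have hpow : ∀ M n, 0 ≤ M → ∀ t ∈ Icc 0 T,
      (C ^ n * M) * (t ^ n / n !) ≤ M * ((C * T) ^ n / n !) := by
    intro M n hM t ht
    rw [mul_pow, mul_comm (C ^ n) M, mul_assoc, mul_div_assoc]
    have := ht.1
    have := ht.2
    gcongr
  have hsum : ∀ M, Summable fun n : ℕ => M * ((C * T) ^ n / n !) := fun M =>
    (Real.summable_pow_div_factorial (C * T)).mul_left M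
  obtain ⟨M, hM, hM01⟩ := exists_abs_sub_le (hseq 1) (hseq 0)
  have hdiff : ∀ n k, ∀ t ∈ Icc 0 T,
      |yseq (n + 1) k t - yseq n k t| ≤ (C ^ n * M) * (t ^ n / n !) := by
    intro n
    induction n with
    | zero => simpa using hM01
    | succ n ih =>
      intro k t ht
      have := hpic _ _ (hseq (n + 1)) (hseq n) _ n (by positivity) ih k t ht
      rwa [← hstep, ← hstep, ← mul_assoc, ← pow_succ'] at this
  have hdist : ∀ k, ∀ t ∈ Icc 0 T, ∀ n,
      dist (yseq n k t) (yseq (n + 1) k t) ≤ M * ((C * T) ^ n / n !) := by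
    intro k t ht n
    rw [dist_comm]
    exact (hdiff n k t ht).trans (hpow M n hM t ht)
  have hlim : ∀ k t, ∃ L, t ∈ Icc 0 T → Tendsto (fun n => yseq n k t) atTop (𝓝 L) := by
    intro k t
    by_cases ht : t ∈ Icc 0 T
    · obtain ⟨L, hL⟩ := cauchySeq_tendsto_of_complete
        (cauchySeq_of_dist_le_of_summable _ (hdist k t ht) (hsum M))
      exact ⟨L, fun _ => hL⟩
    · exact ⟨0, fun h => absurd h ht⟩
  choose y hy using hlim
  let b : ℕ → ℝ := fun n => ∑' m, M * ((C * T) ^ (n + m) / (n + m)!)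
  have hb : Tendsto b atTop (𝓝 0) := by
    simpa only [b, add_comm] using
      tendsto_sum_nat_add fun n : ℕ => M * ((C * T) ^ n / n !)
  have hyb : ∀ n k, ∀ t ∈ Icc 0 T, |yseq n k t - y k t| ≤ b n := fun n k t ht =>
    dist_le_tsum_of_dist_le_of_tendsto _ (hdist k t ht) (hsum M) (hy k t ht) n
  have hunif : ∀ k, TendstoUniformlyOn (fun n => yseq n k) (y k) atTop (Icc 0 T) := by
    intro k
    rw [Metric.tendstoUniformlyOn_iff]
    intro ε hε
    filter_upwards [hb.eventually_lt_const hε] with n hn t ht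
    rw [dist_comm]
    exact (hyb n k t ht).trans_lt hn
  have hycad : ∀ k, CadlagOn (y k) T := fun k =>
    CadlagOn.of_tendstoUniformlyOn (fun n => hseq n k) (hunif k)
  have hfix : ∀ k, ∀ t ∈ Icc 0 T, y k t = picard η p q ξ ζ y k t := by
    intro k t ht
    refine tendsto_nhds_unique ((hy k t ht).comp (tendsto_add_atTop_nat 1)) ?_
    rw [tendsto_iff_dist_tendsto_zero]
    have hb' : Tendsto (fun n => C * b n * t) atTop (𝓝 0) := by
      simpa using (hb.const_mul C).mul_const t
    refine squeeze_zero (fun _ => dist_nonneg) (fun n => ?_) hb'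
    have hbn : 0 ≤ b n := (abs_nonneg _).trans (hyb n k t ht)
    have := hpic _ _ (hseq n) hycad (b n) 0 hbn (by simpa using hyb n) k t ht
    simpa [hstep, Real.dist_eq] using this
  refine ⟨y, hycad, hfix, fun y' hy'cad hy'fix k t ht => ?_, hunif⟩
  obtain ⟨N, hN, hNb⟩ := exists_abs_sub_le hy'cad hycad
  have hiter : ∀ n k, ∀ t ∈ Icc 0 T, |y' k t - y k t| ≤ (C ^ n * N) * (t ^ n / n !) := by
    intro n
    induction n with
    | zero => simpa using hNb
    | succ n ih =>
      intro k t ht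
      have := hpic _ _ hy'cad hycad _ n (by positivity) ih k t ht
      rw [← hfix k t ht, ← mul_assoc, ← pow_succ'] at this
      rwa [← show y' k t = picard η p q ξ ζ y' k t from hy'fix k t ht] at this
  have hle : |y' k t - y k t| ≤ 0 := ge_of_tendsto' (hsum N).tendsto_atTop_zero fun n =>
    (hiter n k t ht).trans (hpow N n hN t ht)
  exact sub_eq_zero.1 (abs_nonpos_iff.1 hle)
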